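/- arXiv:2103.04196 — 2 statements merged into one kernel-verified Lean document; each statement's English description precedes it below -/
import Mathlib

section
/- Let m, n ≥ 1, 0 ≤ k ≤ min(m,n), and let (p̂,q̂) ∈ 𝒫ᵏ_{m,n}. Then there exists a neighborhood D of (p̂,q̂) in the coefficient space ℂ^{m+1} × ℂ^{n+1} such that for every (p,q) ∈ D ∩ 𝒞_{m,n}, there exists exactly one pair (p̃,q̃) ∈ 𝒫ᵏ_{m,n} with ‖(p−p̃, q−q̃)‖ = θ_k(p,q); in particular the greatest common divisor of this nearest pair — the numerical GCD of (p,q) — is unique up to multiplication by nonzero constants. -/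
open Polynomial

/-- The squared ℓ²-norm of the coefficient sequence of a polynomial. -/
noncomputable def pnormSq (p : ℂ[X]) : ℝ := ∑ i ∈ p.support, ‖p.coeff i‖ ^ 2

/-- The ℓ²-norm of the coefficient sequence of a polynomial. -/
noncomputable def pnorm (p : ℂ[X]) : ℝ := Real.sqrt (pnormSq p)

/-- The ℓ²-norm of a pair of polynomials. -/
noncomputable def pairNorm (p q : ℂ[X]) : ℝ := Real.sqrt (pnormSq p + pnormSq q)

/-- The ℓ²-norm of a triple of polynomials. -/
noncomputable def tripleNorm (p q r : ℂ[X]) : ℝ :=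
  Real.sqrt (pnormSq p + pnormSq q + pnormSq r)

/-- The degree of the greatest common divisor of two polynomials. -/
noncomputable def gcdDeg (p q : ℂ[X]) : ℕ := (EuclideanDomain.gcd p q).natDegree

/-- The set 𝒞_{m,n} of pairs of polynomials of degrees exactly m and n. -/
def Cmn (m n : ℕ) : Set (ℂ[X] × ℂ[X]) :=
  {pq | pq.1.degree = (m : WithBot ℕ) ∧ pq.2.degree = (n : WithBot ℕ)}

/-- The GCD manifold 𝒫ᵏ_{m,n} : pairs in 𝒞_{m,n} whose GCD has degree k. -/
def Pmnk (m n k : ℕ) : Set (ℂ[X] × ℂ[X]) :=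
  {pq | pq ∈ Cmn m n ∧ gcdDeg pq.1 pq.2 = k}

/-- The distance θ_k(p,q) from (p,q) to the GCD manifold 𝒫ᵏ_{m,n}. -/
noncomputable def theta (m n k : ℕ) (p q : ℂ[X]) : ℝ :=
  sInf ((fun rs => pairNorm (p - rs.1) (q - rs.2)) '' Pmnk m n k)

/-- The bilinear Sylvester expression (w,v) ↦ p·w − q·v as a linear map. -/
noncomputable def sylMap (p q : ℂ[X]) : ℂ[X] × ℂ[X] →ₗ[ℂ] ℂ[X] :=
  (LinearMap.mulLeft ℂ p).comp (LinearMap.fst ℂ ℂ[X] ℂ[X]) -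
    (LinearMap.mulLeft ℂ q).comp (LinearMap.snd ℂ ℂ[X] ℂ[X])

/-- The domain V_j = {(w,v) : deg w ≤ n−j, deg v ≤ m−j} of the j-th Sylvester map. -/
noncomputable def Vspace (m n j : ℕ) : Submodule ℂ (ℂ[X] × ℂ[X]) :=
  (Polynomial.degreeLE ℂ ((n - j : ℕ) : WithBot ℕ)).prod
    (Polynomial.degreeLE ℂ ((m - j : ℕ) : WithBot ℕ))

open Filter Topology in
/-- A map from a finite-dimensional space with injective derivative at `zh` is bounded below,
in the Lipschitz sense, near `zh`. -/
theorem HasStrictFDerivAt.exists_le_norm_sub_of_injective {Z X : Type*}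
    [NormedAddCommGroup Z] [NormedSpace ℝ Z] [FiniteDimensional ℝ Z]
    [NormedAddCommGroup X] [NormedSpace ℝ X] {F : Z → X} {D : Z →L[ℝ] X} {zh : Z}
    (hF : HasStrictFDerivAt F D zh) (hD : ∀ h, D h = 0 → h = 0) :
    ∃ c > 0, ∀ᶠ ab in 𝓝 (zh, zh), c * ‖ab.1 - ab.2‖ ≤ ‖F ab.1 - F ab.2‖ := by
  obtain ⟨K, hK, hA⟩ := D.toLinearMap.exists_antilipschitzWith (LinearMap.ker_eq_bot'.2 hD)
  have hK' : (0 : ℝ) < K := hK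
  refine ⟨(2 * K : ℝ)⁻¹, by positivity, ?_⟩
  filter_upwards [hF.isLittleO.def (show (0 : ℝ) < (2 * K : ℝ)⁻¹ by positivity)] with ab hab
  have h₁ : ‖ab.1 - ab.2‖ ≤ K * ‖D (ab.1 - ab.2)‖ := by
    simpa [dist_eq_norm] using hA.le_mul_dist (ab.1 - ab.2) 0
  have h₂ : ‖D (ab.1 - ab.2)‖ ≤
      ‖F ab.1 - F ab.2‖ + ‖F ab.1 - F ab.2 - D (ab.1 - ab.2)‖ := by
    simpa using norm_sub_le (F ab.1 - F ab.2) (F ab.1 - F ab.2 - D (ab.1 - ab.2))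
  have h₃ : (K : ℝ)⁻¹ * ‖ab.1 - ab.2‖ ≤ ‖D (ab.1 - ab.2)‖ := by
    rwa [inv_mul_le_iff₀ hK']
  have h₄ : (K : ℝ)⁻¹ = (2 * K : ℝ)⁻¹ + (2 * K : ℝ)⁻¹ := by field_simp; norm_num
  rw [h₄, add_mul] at h₃
  linarith

/-- A continuous map which is homogeneous of degree two grows at most quadratically. -/
theorem exists_norm_le_mul_sq_of_homogeneous {Z X : Type*}
    [NormedAddCommGroup Z] [NormedSpace ℝ Z] [FiniteDimensional ℝ Z]
    [NormedAddCommGroup X] [NormedSpace ℝ X] {Q : Z → X} (hQ : Continuous Q)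
    (hQ₂ : ∀ (t : ℝ) h, Q (t • h) = t ^ 2 • Q h) :
    ∃ C > 0, ∀ h, ‖Q h‖ ≤ C * ‖h‖ ^ 2 := by
  have := FiniteDimensional.proper_real Z
  obtain ⟨C, hC⟩ := (isCompact_closedBall (0 : Z) 1).exists_bound_of_continuousOn hQ.continuousOn
  refine ⟨max C 1, by positivity, fun h => ?_⟩
  have hb : ‖Q (‖h‖⁻¹ • h)‖ ≤ max C 1 := by
    refine (hC _ ?_).trans (le_max_left _ _)
    rw [mem_closedBall_zero_iff, norm_smul, norm_inv, norm_norm]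
    exact inv_mul_le_one
  rcases eq_or_ne h 0 with rfl | hh
  · have hzero : Q 0 = 0 := by simpa using hQ₂ 0 0
    simp [hzero]
  · have : Q h = ‖h‖ ^ 2 • Q (‖h‖⁻¹ • h) := by
      rw [← hQ₂, smul_smul, mul_inv_cancel₀ (norm_ne_zero_iff.2 hh), one_smul]
    rw [this, norm_smul, norm_pow, norm_norm, mul_comm]
    gcongr

open Filter Topology in
/-- If a quadratic curve starting at `a` locally stays at least as far from `y` as `a`, its initial
velocity has nonpositive inner product with `y - a`. -/
theorem inner_nonpos_of_norm_le_of_quadratic {X : Type*} [NormedAddCommGroup X]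
    [InnerProductSpace ℝ X] {e l q : X}
    (h : ∀ t ∈ Set.Icc (0 : ℝ) 1, ‖e‖ ≤ ‖e - (t • l + t ^ 2 • q)‖) : inner ℝ e l ≤ 0 := by
  have key : ∀ t ∈ Set.Ioc (0 : ℝ) 1,
      2 * inner ℝ e l ≤ t * ‖l + t • q‖ ^ 2 - 2 * t * inner ℝ e q := by
    intro t ht
    have h₁ := h t ⟨ht.1.le, ht.2⟩
    have h₂ : ‖e‖ ^ 2 ≤ ‖e - (t • l + t ^ 2 • q)‖ ^ 2 := by gcongr
    have h₃ : t • l + t ^ 2 • q = t • (l + t • q) := by rw [smul_add, smul_smul, sq]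
    rw [norm_sub_sq_real, h₃, inner_smul_right, inner_add_right, inner_smul_right, norm_smul,
      mul_pow, Real.norm_eq_abs, sq_abs] at h₂
    have h₄ : t * (2 * inner ℝ e l) ≤ t * (t * ‖l + t • q‖ ^ 2 - 2 * t * inner ℝ e q) := by
      linarith
    exact le_of_mul_le_mul_left h₄ ht.1
  have hlim : Tendsto (fun t : ℝ => t * ‖l + t • q‖ ^ 2 - 2 * t * inner ℝ e q)
      (𝓝[>] 0) (𝓝 0) := by
    have : Continuous (fun t : ℝ => t * ‖l + t • q‖ ^ 2 - 2 * t * inner ℝ e q) := by fun_prop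
    simpa using (this.tendsto 0).mono_left nhdsWithin_le_nhds
  have := ge_of_tendsto hlim (b := 2 * inner ℝ e l) <| by
    filter_upwards [Ioc_mem_nhdsGT (zero_lt_one (α := ℝ))] with t ht using key t ht
  linarith

open Filter Topology Metric in
/-- Nearest points on a set which is locally the image of a proper injective quadratic immersion
exist and are unique near that set. -/
theorem exists_unique_nearest_of_quadratic_immersion {Z X : Type*}
    [NormedAddCommGroup Z] [NormedSpace ℝ Z] [FiniteDimensional ℝ Z]
    [NormedAddCommGroup X] [InnerProductSpace ℝ X] {F : Z → X} {L : Z → Z → X} {Q : Z → X}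
    (hF : ContDiff ℝ 1 F) (hQ : Continuous Q) (hQ₂ : ∀ (t : ℝ) h, Q (t • h) = t ^ 2 • Q h)
    (hexp : ∀ z h (t : ℝ), F (z + t • h) = F z + (t • L z h + t ^ 2 • Q h))
    {zh : Z} (hL : ∀ h, L zh h = 0 → h = 0) {M : Set X} (hM : ∀ᶠ z in 𝓝 zh, F z ∈ M)
    (hinj : ∀ z, F z = F zh → z = zh) {R ε : ℝ} (hε : 0 < ε)
    (hprop : ∀ x ∈ M, dist x (F zh) < ε → ∃ z, ‖z‖ ≤ R ∧ F z = x) :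
    ∃ δ > 0, ∀ y, dist y (F zh) < δ → ∃! x, x ∈ M ∧ ∀ x' ∈ M, dist y x ≤ dist y x' := by
  have := FiniteDimensional.proper_real Z
  have hstrict : HasStrictFDerivAt F (fderiv ℝ F zh) zh :=
    hF.contDiffAt.hasStrictFDerivAt one_ne_zero
  have hfderiv : ∀ h, fderiv ℝ F zh h = L zh h := by
    intro h
    have h₁ : HasDerivAt (fun t : ℝ => F (zh + t • h)) (fderiv ℝ F zh h) 0 := by
      have hl : HasDerivAt (fun t : ℝ => zh + t • h) h 0 := by
        simpa using ((hasDerivAt_id (0 : ℝ)).smul_const h).const_add zh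
      have hs : HasFDerivAt F (fderiv ℝ F zh) (zh + (0 : ℝ) • h) := by
        simpa using hstrict.hasFDerivAt
      exact hs.comp_hasDerivAt (0 : ℝ) hl
    have h₂ : HasDerivAt (fun t : ℝ => F (zh + t • h)) (L zh h) 0 := by
      simp only [hexp]
      simpa using (((hasDerivAt_id (0 : ℝ)).smul_const (L zh h)).add
        (((hasDerivAt_id (0 : ℝ)).pow 2).smul_const (Q h))).const_add (F zh)
    exact h₁.unique h₂
  obtain ⟨c, hc, hlow⟩ := hstrict.exists_le_norm_sub_of_injective fun h hh =>
    hL h (by rwa [← hfderiv])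
  obtain ⟨C, hC, hquad⟩ := exists_norm_le_mul_sq_of_homogeneous hQ hQ₂
  rw [nhds_prod_eq] at hlow
  obtain ⟨s, hs, hlow⟩ := eventually_prod_self_iff'.1 hlow
  obtain ⟨r, hr, hball⟩ := nhds_basis_closedBall.mem_iff.1 (inter_mem hs hM)
  -- the part of the parameter domain outside the ball stays away from `F zh`
  have hcpt : IsCompact (F '' (closedBall 0 R \ ball zh r)) :=
    ((isCompact_closedBall _ _).diff isOpen_ball).image hF.continuous
  have haway : (F '' (closedBall 0 R \ ball zh r))ᶜ ∈ 𝓝 (F zh) := by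
    refine hcpt.isClosed.isOpen_compl.mem_nhds ?_
    rintro ⟨z, ⟨-, hz⟩, hz'⟩
    exact hz (hinj z hz' ▸ mem_ball_self hr)
  obtain ⟨η, hη, hηsub⟩ := nhds_basis_ball.mem_iff.1 haway
  have hloc : ∀ x ∈ M, dist x (F zh) < min ε η → ∃ z ∈ closedBall zh r, F z = x := by
    intro x hx hd
    obtain ⟨z, hzR, rfl⟩ := hprop x hx (hd.trans_le (min_le_left _ _))
    refine ⟨z, ball_subset_closedBall ?_, rfl⟩
    by_contra hz
    exact hηsub (mem_ball.2 (hd.trans_le (min_le_right _ _)))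
      ⟨z, ⟨mem_closedBall_zero_iff.2 hzR, hz⟩, rfl⟩
  refine ⟨min (min ε η / 2) (c ^ 2 / (4 * C)), by positivity, fun y hy => ?_⟩
  have hy₁ := hy.trans_le (min_le_left _ _)
  have hy₂ := hy.trans_le (min_le_right _ _)
  have hnear : ∀ x ∈ M, dist y x ≤ dist y (F zh) → ∃ z ∈ closedBall zh r, F z = x := by
    intro x hx hd
    refine hloc x hx ?_
    have := dist_triangle_left x (F zh) y
    linarith
  obtain ⟨z₀, hz₀, hmin⟩ := (isCompact_closedBall zh r).exists_isMinOn
    ⟨zh, mem_closedBall_self hr.le⟩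
    (continuous_const.dist hF.continuous : Continuous fun z => dist y (F z)).continuousOn
  have hmin' : ∀ x' ∈ M, dist y (F z₀) ≤ dist y x' := by
    intro x' hx'
    by_cases hd : dist y x' ≤ dist y (F zh)
    · obtain ⟨z, hz, rfl⟩ := hnear x' hx' hd
      exact hmin hz
    · exact (hmin (mem_closedBall_self hr.le)).trans (not_le.1 hd).le
  refine ⟨F z₀, ⟨(hball hz₀).2, hmin'⟩, ?_⟩
  rintro x ⟨hxM, hx⟩
  obtain ⟨z, hz, rfl⟩ := hnear x hxM (hx _ hM.self_of_nhds)
  set h := z - z₀ with hh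
  have hexp₁ : F z = F z₀ + (L z₀ h + Q h) := by simpa [hh] using hexp z₀ h 1
  have hinner : inner ℝ (y - F z₀) (L z₀ h) ≤ 0 := by
    refine inner_nonpos_of_norm_le_of_quadratic (q := Q h) fun t ht => ?_
    have hmem : z₀ + t • h ∈ closedBall zh r :=
      (convex_closedBall zh r).add_smul_sub_mem hz₀ hz ht
    have := hmin' _ (hball hmem).2
    rw [hexp, dist_eq_norm, dist_eq_norm] at this
    rwa [sub_sub]
  have hlow' : c * ‖h‖ ≤ ‖L z₀ h + Q h‖ := by
    have := hlow z (hball hz).1 z₀ (hball hz₀).1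
    simpa [hexp₁, ← hh] using this
  have hle : ‖y - F z₀ - (L z₀ h + Q h)‖ ≤ ‖y - F z₀‖ := by
    have := hx _ (hball hz₀).2
    rwa [hexp₁, dist_eq_norm, dist_eq_norm, ← sub_sub] at this
  have hyz : ‖y - F z₀‖ < c ^ 2 / (4 * C) := by
    rw [← dist_eq_norm]
    exact (hmin' _ hM.self_of_nhds).trans_lt hy₂
  have hq : inner ℝ (y - F z₀) (Q h) ≤ ‖y - F z₀‖ * (C * ‖h‖ ^ 2) :=
    (real_inner_le_norm _ _).trans (by gcongr; exact hquad h)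
  have h₁ : ‖y - F z₀ - (L z₀ h + Q h)‖ ^ 2 ≤ ‖y - F z₀‖ ^ 2 := by gcongr
  rw [norm_sub_sq_real, inner_add_right] at h₁
  have h₂ : (c * ‖h‖) ^ 2 ≤ ‖L z₀ h + Q h‖ ^ 2 := by gcongr
  have hzero : ‖h‖ = 0 := by
    by_contra hne
    have hpos : 0 < ‖h‖ ^ 2 := by positivity
    rw [lt_div_iff₀ (by positivity)] at hyz
    nlinarith [mul_lt_mul_of_pos_right hyz hpos, mul_pos (pow_pos hc 2) hpos]
  rw [sub_eq_zero.1 (norm_eq_zero.1 hzero)]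

/-- The polynomial of degree less than `N` with the given coefficients. -/
noncomputable def polyOfCoeffs {N : ℕ} (a : Fin N → ℂ) : ℂ[X] := ∑ i : Fin N, monomial (i : ℕ) (a i)

theorem coeff_polyOfCoeffs {N : ℕ} (a : Fin N → ℂ) (j : ℕ) :
    (polyOfCoeffs a).coeff j = if h : j < N then a ⟨j, h⟩ else 0 := by
  simp only [polyOfCoeffs, finsetSum_coeff, coeff_monomial]
  split_ifs with h
  · rw [Finset.sum_eq_single ⟨j, h⟩] <;> simp +contextual [Fin.ext_iff]
  · refine Finset.sum_eq_zero fun i _ => ?_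
    rw [if_neg (by omega)]

theorem coeff_polyOfCoeffs_fin {N : ℕ} (a : Fin N → ℂ) (i : Fin N) :
    (polyOfCoeffs a).coeff i = a i := by
  rw [coeff_polyOfCoeffs, dif_pos i.2]

theorem degree_polyOfCoeffs_lt {N : ℕ} (a : Fin N → ℂ) : (polyOfCoeffs a).degree < N := by
  rw [degree_lt_iff_coeff_zero]
  intro j hj
  rw [coeff_polyOfCoeffs, dif_neg (not_lt.2 hj)]

theorem degree_polyOfCoeffs_le {N : ℕ} (a : Fin (N + 1) → ℂ) : (polyOfCoeffs a).degree ≤ N := by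
  rw [degree_le_iff_coeff_zero]
  intro j hj
  rw [coeff_polyOfCoeffs, dif_neg (not_lt.2 (Nat.succ_le_of_lt (by exact_mod_cast hj)))]

theorem polyOfCoeffs_coeff {N : ℕ} {p : ℂ[X]} (hp : p.degree < N) :
    polyOfCoeffs (fun i : Fin N => p.coeff i) = p := by
  ext j
  rw [coeff_polyOfCoeffs]
  split_ifs with h
  · rfl
  · exact ((degree_lt_iff_coeff_zero _ _).1 hp j (not_lt.1 h)).symm

theorem polyOfCoeffs_add {N : ℕ} (a b : Fin N → ℂ) :
    polyOfCoeffs (a + b) = polyOfCoeffs a + polyOfCoeffs b := by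
  simp [polyOfCoeffs, Finset.sum_add_distrib]

theorem polyOfCoeffs_smul {N : ℕ} (t : ℝ) (a : Fin N → ℂ) :
    polyOfCoeffs (t • a) = C (t : ℂ) * polyOfCoeffs a := by
  simp [polyOfCoeffs, Finset.mul_sum, C_mul_monomial]

theorem polyOfCoeffs_injective {N : ℕ} : Function.Injective (polyOfCoeffs (N := N)) := by
  intro a b h
  ext i
  simpa [coeff_polyOfCoeffs] using congrArg (fun p => coeff p i) h

theorem polyOfCoeffs_eq_zero {N : ℕ} {a : Fin N → ℂ} (h : polyOfCoeffs a = 0) : a = 0 :=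
  polyOfCoeffs_injective (h.trans (by simp [polyOfCoeffs]))

theorem contDiff_coeff_polyOfCoeffs {N : ℕ} (j : ℕ) :
    ContDiff ℝ 1 fun a : Fin N → ℂ => (polyOfCoeffs a).coeff j := by
  simp only [coeff_polyOfCoeffs]
  split_ifs <;> fun_prop

/-- The coefficient vector of a pair of polynomials of degrees at most `m` and `n`. -/
noncomputable def pairCoeffs (m n : ℕ) (pq : ℂ[X] × ℂ[X]) :
    EuclideanSpace ℂ (Fin (m + 1) ⊕ Fin (n + 1)) :=
  WithLp.toLp 2 (Sum.elim (fun i => pq.1.coeff i) (fun j => pq.2.coeff j))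

theorem pairCoeffs_add (m n : ℕ) (a b : ℂ[X] × ℂ[X]) :
    pairCoeffs m n (a + b) = pairCoeffs m n a + pairCoeffs m n b := by
  ext (i | i) <;> simp [pairCoeffs]

theorem pairCoeffs_sub (m n : ℕ) (a b : ℂ[X] × ℂ[X]) :
    pairCoeffs m n (a - b) = pairCoeffs m n a - pairCoeffs m n b := by
  ext (i | i) <;> simp [pairCoeffs]

theorem pairCoeffs_C_mul (m n : ℕ) (t : ℝ) (a : ℂ[X] × ℂ[X]) :
    pairCoeffs m n ((C (t : ℂ), C (t : ℂ)) * a) = t • pairCoeffs m n a := by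
  ext (i | i) <;> simp [pairCoeffs]

theorem pnormSq_eq_sum_fin {m : ℕ} {p : ℂ[X]} (hp : p.degree ≤ m) :
    pnormSq p = ∑ i : Fin (m + 1), ‖p.coeff i‖ ^ 2 := by
  rw [Fin.sum_univ_eq_sum_range (fun i => ‖p.coeff i‖ ^ 2), pnormSq]
  refine Finset.sum_subset (fun i hi => ?_) (fun i _ hi => ?_)
  · rw [Finset.mem_range]
    have := (le_degree_of_mem_supp i hi).trans hp
    exact Nat.lt_succ_of_le (by exact_mod_cast this)
  · simp [notMem_support_iff.1 hi]

theorem norm_pairCoeffs {m n : ℕ} {p q : ℂ[X]} (hp : p.degree ≤ m) (hq : q.degree ≤ n) :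
    ‖pairCoeffs m n (p, q)‖ = pairNorm p q := by
  rw [EuclideanSpace.norm_eq, pairNorm, pnormSq_eq_sum_fin hp, pnormSq_eq_sum_fin hq]
  simp [pairCoeffs]

theorem pairCoeffs_eq_zero {m n : ℕ} {p q : ℂ[X]} (hp : p.degree ≤ m) (hq : q.degree ≤ n)
    (h : pairCoeffs m n (p, q) = 0) : p = 0 ∧ q = 0 := by
  constructor <;> ext j
  · by_cases hj : j < m + 1
    · simpa [pairCoeffs] using congrArg (fun x => x (Sum.inl ⟨j, hj⟩)) h
    · exact coeff_eq_zero_of_degree_lt (hp.trans_lt (by exact_mod_cast not_le.1 (by omega)))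
  · by_cases hj : j < n + 1
    · simpa [pairCoeffs] using congrArg (fun x => x (Sum.inr ⟨j, hj⟩)) h
    · exact coeff_eq_zero_of_degree_lt (hq.trans_lt (by exact_mod_cast not_le.1 (by omega)))

theorem pairCoeffs_inj {m n : ℕ} {p q r s : ℂ[X]} (hp : p.degree ≤ m) (hq : q.degree ≤ n)
    (hr : r.degree ≤ m) (hs : s.degree ≤ n)
    (h : pairCoeffs m n (p, q) = pairCoeffs m n (r, s)) : p = r ∧ q = s := by
  have h' : pairCoeffs m n (p - r, q - s) = 0 := by
    rw [← Prod.mk_sub_mk, pairCoeffs_sub, h, sub_self]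
  have := pairCoeffs_eq_zero ((degree_sub_le _ _).trans (max_le hp hr))
    ((degree_sub_le _ _).trans (max_le hq hs)) h'
  exact ⟨sub_eq_zero.1 this.1, sub_eq_zero.1 this.2⟩

theorem dist_pairCoeffs {m n : ℕ} {p q r s : ℂ[X]} (hp : p.degree ≤ m) (hq : q.degree ≤ n)
    (hr : r.degree ≤ m) (hs : s.degree ≤ n) :
    dist (pairCoeffs m n (p, q)) (pairCoeffs m n (r, s)) = pairNorm (p - r) (q - s) := by
  rw [dist_eq_norm, ← pairCoeffs_sub, Prod.mk_sub_mk,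
    norm_pairCoeffs ((degree_sub_le _ _).trans (max_le hp hr))
      ((degree_sub_le _ _).trans (max_le hq hs))]

/-- The parameter space for a monic common factor of degree `k` and two cofactors. -/
abbrev FactorParams (m n k : ℕ) : Type :=
  (Fin k → ℂ) × (Fin (m - k + 1) → ℂ) × (Fin (n - k + 1) → ℂ)

namespace FactorParams

variable {m n k : ℕ}

/-- The monic common factor. -/
noncomputable def factor (z : FactorParams m n k) : ℂ[X] := X ^ k + polyOfCoeffs z.1

/-- The cofactor of the first polynomial. -/
noncomputable def cofactorLeft (z : FactorParams m n k) : ℂ[X] := polyOfCoeffs z.2.1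

/-- The cofactor of the second polynomial. -/
noncomputable def cofactorRight (z : FactorParams m n k) : ℂ[X] := polyOfCoeffs z.2.2

theorem monic_factor (z : FactorParams m n k) : z.factor.Monic :=
  monic_X_pow_add (degree_polyOfCoeffs_lt _)

theorem natDegree_factor (z : FactorParams m n k) : z.factor.natDegree = k := by
  refine natDegree_eq_of_degree_eq_some ?_
  rw [factor, degree_add_eq_left_of_degree_lt (by simpa using degree_polyOfCoeffs_lt _),
    degree_X_pow]

theorem degree_cofactorLeft_le (z : FactorParams m n k) :
    z.cofactorLeft.degree ≤ (m - k : ℕ) :=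
  degree_polyOfCoeffs_le _

theorem degree_cofactorRight_le (z : FactorParams m n k) :
    z.cofactorRight.degree ≤ (n - k : ℕ) :=
  degree_polyOfCoeffs_le _

theorem ext_of_factor {z z' : FactorParams m n k} (hu : z.factor = z'.factor)
    (hv : z.cofactorLeft = z'.cofactorLeft) (hw : z.cofactorRight = z'.cofactorRight) :
    z = z' :=
  Prod.ext (polyOfCoeffs_injective (add_left_cancel hu))
    (Prod.ext (polyOfCoeffs_injective hv) (polyOfCoeffs_injective hw))

theorem exists_of_factorization {u v w : ℂ[X]} (hu : u.Monic) (huk : u.natDegree = k)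
    (hv : v.degree ≤ (m - k : ℕ)) (hw : w.degree ≤ (n - k : ℕ)) :
    ∃ z : FactorParams m n k, z.factor = u ∧ z.cofactorLeft = v ∧ z.cofactorRight = w := by
  refine ⟨⟨fun i => (u - X ^ k).coeff i, fun i => v.coeff i, fun i => w.coeff i⟩, ?_,
    polyOfCoeffs_coeff (hv.trans_lt (by exact_mod_cast Nat.lt_succ_self _)),
    polyOfCoeffs_coeff (hw.trans_lt (by exact_mod_cast Nat.lt_succ_self _))⟩
  rw [factor]
  simp only
  rw [polyOfCoeffs_coeff, add_sub_cancel]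
  have hd : u.degree = k := by rw [degree_eq_natDegree hu.ne_zero, huk]
  rw [← hd]
  exact degree_sub_lt_left (by rw [hd, degree_X_pow]) hu.ne_zero (by simp [hu.leadingCoeff])

/-- The pair of polynomials with the given common factor and cofactors. -/
noncomputable def pair (z : FactorParams m n k) : ℂ[X] × ℂ[X] :=
  (z.factor * z.cofactorLeft, z.factor * z.cofactorRight)

theorem degree_mul_cofactor_le {m k : ℕ} {u v : ℂ[X]} (hkm : k ≤ m) (hu : u.degree ≤ k)
    (hv : v.degree ≤ (m - k : ℕ)) : (u * v).degree ≤ m := by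
  refine (degree_mul_le _ _).trans ((add_le_add hu hv).trans ?_)
  exact_mod_cast (Nat.add_sub_of_le hkm).le

theorem degree_factor_le (z : FactorParams m n k) : z.factor.degree ≤ k :=
  degree_le_of_natDegree_le z.natDegree_factor.le

/-- The linear part of the expansion of `pair`. -/
noncomputable def pairLinear (z h : FactorParams m n k) : ℂ[X] × ℂ[X] :=
  (polyOfCoeffs h.1 * z.cofactorLeft + z.factor * h.cofactorLeft,
    polyOfCoeffs h.1 * z.cofactorRight + z.factor * h.cofactorRight)

/-- The quadratic part of the expansion of `pair`. -/
noncomputable def pairQuadratic (h : FactorParams m n k) : ℂ[X] × ℂ[X] :=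
  (polyOfCoeffs h.1 * h.cofactorLeft, polyOfCoeffs h.1 * h.cofactorRight)

theorem pairCoeffs_pair_add_smul (z h : FactorParams m n k) (t : ℝ) :
    pairCoeffs m n (pair (z + t • h)) = pairCoeffs m n z.pair +
      (t • pairCoeffs m n (pairLinear z h) + t ^ 2 • pairCoeffs m n h.pairQuadratic) := by
  rw [← pairCoeffs_C_mul, ← pairCoeffs_C_mul, ← pairCoeffs_add, ← pairCoeffs_add]
  congr 1
  simp only [pair, pairLinear, pairQuadratic, factor, cofactorLeft, cofactorRight, Prod.fst_add,
    Prod.snd_add, Prod.smul_fst, Prod.smul_snd, polyOfCoeffs_add, polyOfCoeffs_smul,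
    Prod.mk_mul_mk, Prod.mk_add_mk, Complex.ofReal_pow, C_pow]
  ext1 <;> simp only <;> ring

theorem pairCoeffs_pairQuadratic_smul (t : ℝ) (h : FactorParams m n k) :
    pairCoeffs m n (pairQuadratic (t • h)) = t ^ 2 • pairCoeffs m n h.pairQuadratic := by
  rw [← pairCoeffs_C_mul]
  congr 1
  simp only [pairQuadratic, cofactorLeft, cofactorRight, Prod.smul_fst, Prod.smul_snd,
    polyOfCoeffs_smul, Prod.mk_mul_mk, Complex.ofReal_pow, C_pow]
  ext1 <;> simp only <;> ring

theorem contDiff_pairCoeffs_pair :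
    ContDiff ℝ 1 fun z : FactorParams m n k => pairCoeffs m n z.pair := by
  have hu : ∀ j, ContDiff ℝ 1 fun z : FactorParams m n k => z.factor.coeff j := fun j => by
    simp only [factor, coeff_add]
    exact contDiff_const.add ((contDiff_coeff_polyOfCoeffs j).comp contDiff_fst)
  have hv : ∀ j, ContDiff ℝ 1 fun z : FactorParams m n k => z.cofactorLeft.coeff j := fun j =>
    (contDiff_coeff_polyOfCoeffs j).comp (contDiff_fst.comp contDiff_snd)
  have hw : ∀ j, ContDiff ℝ 1 fun z : FactorParams m n k => z.cofactorRight.coeff j := fun j =>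
    (contDiff_coeff_polyOfCoeffs j).comp (contDiff_snd.comp contDiff_snd)
  rw [contDiff_piLp]
  rintro (i | i) <;> simp only [pairCoeffs, pair, coeff_mul, Sum.elim_inl, Sum.elim_inr]
  · exact ContDiff.sum fun x _ => (hu x.1).mul (hv x.2)
  · exact ContDiff.sum fun x _ => (hu x.1).mul (hw x.2)

theorem continuous_coeff_cofactorLeft (j : ℕ) :
    Continuous fun z : FactorParams m n k => z.cofactorLeft.coeff j :=
  (contDiff_coeff_polyOfCoeffs j).continuous.comp (continuous_fst.comp continuous_snd)

theorem continuous_coeff_cofactorRight (j : ℕ) :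
    Continuous fun z : FactorParams m n k => z.cofactorRight.coeff j :=
  (contDiff_coeff_polyOfCoeffs j).continuous.comp (continuous_snd.comp continuous_snd)

theorem continuous_pairCoeffs_pairQuadratic :
    Continuous fun z : FactorParams m n k => pairCoeffs m n z.pairQuadratic := by
  have hu : ∀ j, Continuous fun z : FactorParams m n k => (polyOfCoeffs z.1).coeff j := fun j =>
    (contDiff_coeff_polyOfCoeffs j).continuous.comp continuous_fst
  refine (PiLp.continuous_toLp 2 _).comp (continuous_pi ?_)
  rintro (i | i) <;> simp only [pairQuadratic, coeff_mul, Sum.elim_inl, Sum.elim_inr]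
  · exact continuous_finsetSum _ fun x _ => (hu x.1).mul (continuous_coeff_cofactorLeft x.2)
  · exact continuous_finsetSum _ fun x _ => (hu x.1).mul (continuous_coeff_cofactorRight x.2)

theorem degree_pair_fst_le (hkm : k ≤ m) (z : FactorParams m n k) : z.pair.1.degree ≤ m :=
  degree_mul_cofactor_le hkm z.degree_factor_le z.degree_cofactorLeft_le

theorem degree_pair_snd_le (hkn : k ≤ n) (z : FactorParams m n k) : z.pair.2.degree ≤ n :=
  degree_mul_cofactor_le hkn z.degree_factor_le z.degree_cofactorRight_le

theorem pair_mem_Pmnk (hkm : k ≤ m) (hkn : k ≤ n) {z : FactorParams m n k}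
    (hv : z.cofactorLeft.degree = (m - k : ℕ)) (hw : z.cofactorRight.degree = (n - k : ℕ))
    (hc : IsCoprime z.cofactorLeft z.cofactorRight) : z.pair ∈ Pmnk m n k := by
  have hu : z.factor.degree = k := by
    rw [degree_eq_natDegree z.monic_factor.ne_zero, z.natDegree_factor]
  refine ⟨⟨?_, ?_⟩, ?_⟩
  · rw [pair, degree_mul, hu, hv]
    exact_mod_cast Nat.add_sub_of_le hkm
  · rw [pair, degree_mul, hu, hw]
    exact_mod_cast Nat.add_sub_of_le hkn
  · have hassoc : Associated (EuclideanDomain.gcd z.pair.1 z.pair.2) z.factor := by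
      refine associated_of_dvd_dvd ?_
        (EuclideanDomain.dvd_gcd (dvd_mul_right _ _) (dvd_mul_right _ _))
      obtain ⟨a, b, hab⟩ := hc
      have : z.factor = a * z.pair.1 + b * z.pair.2 := by
        simp only [pair]
        linear_combination -z.factor * hab
      rw [this]
      exact dvd_add ((EuclideanDomain.gcd_dvd_left _ _).mul_left _)
        ((EuclideanDomain.gcd_dvd_right _ _).mul_left _)
    rw [gcdDeg, natDegree_eq_of_degree_eq (degree_eq_degree_of_associated hassoc),
      z.natDegree_factor]

theorem exists_pair_eq_of_mem_Pmnk {p q : ℂ[X]} (h : (p, q) ∈ Pmnk m n k) :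
    ∃ z : FactorParams m n k, z.pair = (p, q) ∧ z.cofactorLeft.degree = (m - k : ℕ) ∧
      z.cofactorRight.degree = (n - k : ℕ) ∧ IsCoprime z.cofactorLeft z.cofactorRight := by
  obtain ⟨⟨hp, hq⟩, hg⟩ := h
  simp only at hp hq hg
  have hp₀ : p ≠ 0 := by rintro rfl; simp at hp
  have hq₀ : q ≠ 0 := by rintro rfl; simp at hq
  set g := EuclideanDomain.gcd p q with hgdef
  have hg₀ : g ≠ 0 := fun h₀ => hp₀ (EuclideanDomain.gcd_eq_zero_iff.1 h₀).1
  have hlc : g.leadingCoeff ≠ 0 := leadingCoeff_ne_zero.2 hg₀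
  have hCC : C g.leadingCoeff⁻¹ * C g.leadingCoeff = (1 : ℂ[X]) := by
    rw [← C_mul, inv_mul_cancel₀ hlc, C_1]
  obtain ⟨a, ha⟩ := EuclideanDomain.gcd_dvd_left p q
  obtain ⟨b, hb⟩ := EuclideanDomain.gcd_dvd_right p q
  rw [← hgdef] at ha hb
  have hbez : a * EuclideanDomain.gcdA p q + b * EuclideanDomain.gcdB p q = 1 := by
    refine mul_left_cancel₀ hg₀ ?_
    have := EuclideanDomain.gcd_eq_gcd_ab p q
    rw [← hgdef] at this
    linear_combination -this - EuclideanDomain.gcdA p q * ha - EuclideanDomain.gcdB p q * hb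
  set u := g * C g.leadingCoeff⁻¹ with hu
  have hmonic : u.Monic := monic_mul_leadingCoeff_inv hg₀
  have huk : u.natDegree = k := by
    rw [hu, natDegree_mul_leadingCoeff_inv _ hg₀]
    exact hg
  have hpu : u * (C g.leadingCoeff * a) = p := by
    rw [hu]
    linear_combination g * a * hCC - ha
  have hqu : u * (C g.leadingCoeff * b) = q := by
    rw [hu]
    linear_combination g * b * hCC - hb
  have hdeg : ∀ {N : ℕ} {r s : ℂ[X]}, r.degree = N → u * s = r → s.degree = (N - k : ℕ) := by
    intro N r s hr hs
    have hs₀ : s ≠ 0 := by rintro rfl; simp [← hs] at hr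
    have hN : r.natDegree = N := natDegree_eq_of_degree_eq_some hr
    rw [degree_eq_natDegree hs₀, ← hN, ← hs, natDegree_mul hmonic.ne_zero hs₀, huk,
      Nat.add_sub_cancel_left]
  have hv := hdeg hp hpu
  have hw := hdeg hq hqu
  obtain ⟨z, hzu, hzv, hzw⟩ := exists_of_factorization hmonic huk hv.le hw.le
  refine ⟨z, by rw [pair, hzu, hzv, hzw, hpu, hqu], by rw [hzv, hv], by rw [hzw, hw], ?_⟩
  rw [hzv, hzw]
  refine ⟨C g.leadingCoeff⁻¹ * EuclideanDomain.gcdA p q,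
    C g.leadingCoeff⁻¹ * EuclideanDomain.gcdB p q, ?_⟩
  linear_combination
    (a * EuclideanDomain.gcdA p q + b * EuclideanDomain.gcdB p q) * hCC + hbez

theorem continuous_resultant_cofactors : Continuous fun z : FactorParams m n k =>
    resultant z.cofactorLeft z.cofactorRight (m - k) (n - k) := by
  refine Continuous.matrix_det (continuous_matrix fun i j => ?_)
  simp only [sylvester, Matrix.of_apply]
  refine Fin.addCases (fun j => ?_) (fun j => ?_) j
  · simp only [Fin.addCases_left]
    split_ifs
    exacts [continuous_coeff_cofactorRight _, continuous_const]
  · simp only [Fin.addCases_right]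
    split_ifs
    exacts [continuous_coeff_cofactorLeft _, continuous_const]

open Topology in
/-- Having a greatest common divisor of degree exactly `k` is stable under small changes of the
factors. -/
theorem eventually_pair_mem_Pmnk (hkm : k ≤ m) (hkn : k ≤ n) {zh : FactorParams m n k}
    (hv : zh.cofactorLeft.degree = (m - k : ℕ)) (hw : zh.cofactorRight.degree = (n - k : ℕ))
    (hc : IsCoprime zh.cofactorLeft zh.cofactorRight) : ∀ᶠ z in 𝓝 zh, z.pair ∈ Pmnk m n k := by
  have hv' := natDegree_eq_of_degree_eq_some hv
  have hw' := natDegree_eq_of_degree_eq_some hw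
  have hres : resultant zh.cofactorLeft zh.cofactorRight (m - k) (n - k) ≠ 0 := by
    have := resultant_ne_zero _ _ hc
    rwa [hv', hw'] at this
  filter_upwards
    [(continuous_coeff_cofactorLeft (m - k)).continuousAt.eventually_ne
      (coeff_ne_zero_of_eq_degree hv),
    (continuous_coeff_cofactorRight (n - k)).continuousAt.eventually_ne
      (coeff_ne_zero_of_eq_degree hw),
    continuous_resultant_cofactors.continuousAt.eventually_ne hres] with z h₁ h₂ h₃
  have hzv := degree_eq_of_le_of_coeff_ne_zero z.degree_cofactorLeft_le h₁
  have hzw := degree_eq_of_le_of_coeff_ne_zero z.degree_cofactorRight_le h₂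
  refine pair_mem_Pmnk hkm hkn hzv hzw ?_
  by_contra hnc
  rw [← natDegree_eq_of_degree_eq_some hzv, ← natDegree_eq_of_degree_eq_some hzw] at h₃
  refine h₃ (resultant_eq_zero_iff.2 ⟨Or.inl fun h₀ => ?_, hnc⟩)
  simp [h₀] at h₁

theorem eq_of_pairCoeffs_pair_eq (hkm : k ≤ m) (hkn : k ≤ n) {z zh : FactorParams m n k}
    (hc : IsCoprime zh.cofactorLeft zh.cofactorRight)
    (h : pairCoeffs m n z.pair = pairCoeffs m n zh.pair) : z = zh := by
  obtain ⟨h₁, h₂⟩ := pairCoeffs_inj (z.degree_pair_fst_le hkm) (z.degree_pair_snd_le hkn)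
    (zh.degree_pair_fst_le hkm) (zh.degree_pair_snd_le hkn) h
  simp only [pair] at h₁ h₂
  obtain ⟨a, b, hab⟩ := hc
  have hdvd : z.factor ∣ zh.factor := by
    refine ⟨a * z.cofactorLeft + b * z.cofactorRight, ?_⟩
    linear_combination -zh.factor * hab - a * h₁ - b * h₂
  have hu : z.factor = zh.factor := by
    refine (eq_of_monic_of_dvd_of_natDegree_le z.monic_factor zh.monic_factor hdvd ?_).symm
    rw [z.natDegree_factor, zh.natDegree_factor]
  rw [hu] at h₁ h₂
  exact ext_of_factor hu (mul_left_cancel₀ zh.monic_factor.ne_zero h₁)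
    (mul_left_cancel₀ zh.monic_factor.ne_zero h₂)

theorem eq_zero_of_pairCoeffs_pairLinear_eq_zero (hkm : k ≤ m) (hkn : k ≤ n)
    {z h : FactorParams m n k} (hc : IsCoprime z.cofactorLeft z.cofactorRight)
    (h₀ : pairCoeffs m n (pairLinear z h) = 0) : h = 0 := by
  have hdu : (polyOfCoeffs h.1).degree < z.factor.degree := by
    rw [degree_eq_natDegree z.monic_factor.ne_zero, z.natDegree_factor]
    exact degree_polyOfCoeffs_lt _
  have hduk := hdu.le.trans z.degree_factor_le
  obtain ⟨h₁, h₂⟩ := pairCoeffs_eq_zero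
    ((degree_add_le _ _).trans (max_le
      (degree_mul_cofactor_le hkm hduk z.degree_cofactorLeft_le)
      (degree_mul_cofactor_le hkm z.degree_factor_le h.degree_cofactorLeft_le)))
    ((degree_add_le _ _).trans (max_le
      (degree_mul_cofactor_le hkn hduk z.degree_cofactorRight_le)
      (degree_mul_cofactor_le hkn z.degree_factor_le h.degree_cofactorRight_le))) h₀
  obtain ⟨a, b, hab⟩ := hc
  have hdvd : z.factor ∣ polyOfCoeffs h.1 := by
    refine ⟨-(a * h.cofactorLeft + b * h.cofactorRight), ?_⟩
    linear_combination -polyOfCoeffs h.1 * hab + a * h₁ + b * h₂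
  have hu : polyOfCoeffs h.1 = 0 := eq_zero_of_dvd_of_degree_lt hdvd hdu
  rw [hu, zero_mul, zero_add, mul_eq_zero, or_iff_right z.monic_factor.ne_zero] at h₁ h₂
  exact Prod.ext (polyOfCoeffs_eq_zero hu)
    (Prod.ext (polyOfCoeffs_eq_zero h₁) (polyOfCoeffs_eq_zero h₂))

theorem norm_le_of_norm_coeff_le {z : FactorParams m n k} {R : ℝ} (hR : 0 ≤ R)
    (hu : ∀ j < k, ‖z.factor.coeff j‖ ≤ R) (hv : ∀ j, ‖z.cofactorLeft.coeff j‖ ≤ R)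
    (hw : ∀ j, ‖z.cofactorRight.coeff j‖ ≤ R) : ‖z‖ ≤ R := by
  refine norm_prod_le_iff.2 ⟨?_, norm_prod_le_iff.2 ⟨?_, ?_⟩⟩ <;>
    refine (pi_norm_le_iff_of_nonneg hR).2 fun i => ?_
  · simpa [factor, coeff_polyOfCoeffs_fin, coeff_X_pow, i.2.ne] using hu i i.2
  · simpa [cofactorLeft, coeff_polyOfCoeffs_fin] using hv i
  · simpa [cofactorRight, coeff_polyOfCoeffs_fin] using hw i

theorem norm_coeff_le_of_mahlerMeasure_le {p : ℂ[X]} {N : ℕ} {B : ℝ} (hp : p.natDegree ≤ N)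
    (hB : p.mahlerMeasure ≤ B) (j : ℕ) : ‖p.coeff j‖ ≤ 2 ^ N * B := by
  have hc : (p.natDegree.choose j : ℝ) ≤ 2 ^ N := by
    exact_mod_cast (Nat.choose_le_two_pow _ j).trans (Nat.pow_le_pow_right two_pos hp)
  have := p.mahlerMeasure_nonneg
  exact (norm_coeff_le_choose_mul_mahlerMeasure j p).trans (by gcongr)

/-- The parameters of pairs near a fixed pair of full degree are bounded. -/
theorem exists_norm_le_of_dist_lt (hkm : k ≤ m) (hkn : k ≤ n) {ph qh : ℂ[X]}
    (hph : ph.degree = m) :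
    ∃ R ε : ℝ, 0 < ε ∧ ∀ z : FactorParams m n k,
      dist (pairCoeffs m n z.pair) (pairCoeffs m n (ph, qh)) < ε → ‖z‖ ≤ R := by
  have hlc : 0 < ‖ph.coeff m‖ := norm_pos_iff.2 (coeff_ne_zero_of_eq_degree hph)
  set ε := ‖ph.coeff m‖ / 2 with hε
  have hε₀ : 0 < ε := by positivity
  set B := ‖pairCoeffs m n (ph, qh)‖ + ε with hB
  have hB₀ : 0 ≤ B := by positivity
  refine ⟨2 ^ (m + n) * (B + B / ε), ε, hε₀, fun z hz => ?_⟩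
  have hpd := z.degree_pair_fst_le hkm
  have hqd := z.degree_pair_snd_le hkn
  rw [dist_eq_norm] at hz
  have hnorm : ‖pairCoeffs m n z.pair‖ ≤ B := by
    have := norm_le_norm_add_norm_sub (pairCoeffs m n (ph, qh)) (pairCoeffs m n z.pair)
    rw [norm_sub_rev] at this
    linarith
  have hlead : ε ≤ ‖z.pair.1.coeff m‖ := by
    have h₁ : ‖z.pair.1.coeff m - ph.coeff m‖ < ε := by
      refine lt_of_le_of_lt ?_ hz
      simpa [pairCoeffs] using PiLp.norm_apply_le
        (pairCoeffs m n z.pair - pairCoeffs m n (ph, qh)) (Sum.inl (Fin.last m))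
    have h₂ := norm_le_norm_add_norm_sub (z.pair.1.coeff m) (ph.coeff m)
    linarith
  have hpm : z.pair.1.degree = m :=
    degree_eq_of_le_of_coeff_ne_zero hpd (norm_pos_iff.1 (hε₀.trans_le hlead))
  have hpair : ‖pairCoeffs m n z.pair‖ = pairNorm z.pair.1 z.pair.2 := norm_pairCoeffs hpd hqd
  have hnonneg : ∀ p, 0 ≤ pnormSq p := fun p => Finset.sum_nonneg fun i _ => by positivity
  have hMp : z.pair.1.mahlerMeasure ≤ B := by
    refine (mahlerMeasure_le_sqrt_sum_sq_norm_coeff _).trans (le_trans ?_ (hpair ▸ hnorm))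
    exact Real.sqrt_le_sqrt (le_add_of_nonneg_right (hnonneg _))
  have hMq : z.pair.2.mahlerMeasure ≤ B := by
    refine (mahlerMeasure_le_sqrt_sum_sq_norm_coeff _).trans (le_trans ?_ (hpair ▸ hnorm))
    exact Real.sqrt_le_sqrt (le_add_of_nonneg_left (hnonneg _))
  rw [pair, mahlerMeasure_mul] at hMp hMq
  have hMu : 1 ≤ z.factor.mahlerMeasure :=
    one_le_mahlerMeasure_of_one_le_norm_leadingCoeff (by simp [z.monic_factor.leadingCoeff])
  have hMv : ε ≤ z.cofactorLeft.mahlerMeasure := by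
    refine (hlead.trans_eq ?_).trans (leadingCoeff_le_mahlerMeasure _)
    rw [← leadingCoeff_monic_mul z.monic_factor (q := z.cofactorLeft), leadingCoeff]
    rw [natDegree_eq_of_degree_eq_some (show (z.factor * z.cofactorLeft).degree = m from hpm)]
    rfl
  have hBε : 0 ≤ B / ε := by positivity
  refine norm_le_of_norm_coeff_le (by positivity)
    (fun j _ => norm_coeff_le_of_mahlerMeasure_le (z.natDegree_factor.le.trans (by omega)) ?_ j)
    (fun j => norm_coeff_le_of_mahlerMeasure_le
      ((natDegree_le_of_degree_le z.degree_cofactorLeft_le).trans (by omega)) ?_ j)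
    (fun j => norm_coeff_le_of_mahlerMeasure_le
      ((natDegree_le_of_degree_le z.degree_cofactorRight_le).trans (by omega)) ?_ j)
  · refine le_trans ?_ (le_add_of_nonneg_left hB₀)
    rw [le_div_iff₀ hε₀]
    exact (mul_le_mul_of_nonneg_left hMv (mahlerMeasure_nonneg _)).trans hMp
  · exact ((le_mul_of_one_le_left (mahlerMeasure_nonneg _) hMu).trans hMp).trans
      (le_add_of_nonneg_right hBε)
  · exact ((le_mul_of_one_le_left (mahlerMeasure_nonneg _) hMu).trans hMq).trans
      (le_add_of_nonneg_right hBε)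

end FactorParams

/-- A pair of `𝒫ᵏ_{m,n}` realizes the distance `θ_k` exactly when it is a nearest pair. -/
theorem pairNorm_eq_theta_iff {m n k : ℕ} {p q : ℂ[X]} {pt : ℂ[X] × ℂ[X]}
    (hpt : pt ∈ Pmnk m n k) :
    pairNorm (p - pt.1) (q - pt.2) = theta m n k p q ↔
      ∀ rs ∈ Pmnk m n k, pairNorm (p - pt.1) (q - pt.2) ≤ pairNorm (p - rs.1) (q - rs.2) := by
  have hbdd : BddBelow ((fun rs => pairNorm (p - rs.1) (q - rs.2)) '' Pmnk m n k) :=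
    ⟨0, by rintro _ ⟨rs, -, rfl⟩; exact Real.sqrt_nonneg _⟩
  constructor
  · intro h rs hrs
    rw [h]
    exact csInf_le hbdd ⟨rs, hrs, rfl⟩
  · intro h
    have hleast : IsLeast ((fun rs => pairNorm (p - rs.1) (q - rs.2)) '' Pmnk m n k)
        (pairNorm (p - pt.1) (q - pt.2)) :=
      ⟨⟨pt, hpt, rfl⟩, by rintro _ ⟨rs, hrs, rfl⟩; exact h rs hrs⟩
    exact hleast.csInf_eq.symm

/-- Near (p̂,q̂) ∈ 𝒫ᵏ_{m,n}, the nearest pair on 𝒫ᵏ_{m,n} is unique. -/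
theorem nearest_pair_unique (m n k : ℕ) (hm : 1 ≤ m) (hn : 1 ≤ n) (hk : k ≤ min m n)
    (ph qh : ℂ[X]) (hmem : (ph, qh) ∈ Pmnk m n k) :
    ∃ δ : ℝ, 0 < δ ∧ ∀ p q : ℂ[X], (p, q) ∈ Cmn m n →
      pairNorm (p - ph) (q - qh) < δ →
      ∃! pt : ℂ[X] × ℂ[X], pt ∈ Pmnk m n k ∧
        pairNorm (p - pt.1) (q - pt.2) = theta m n k p q := by
  obtain ⟨hkm, hkn⟩ := le_min_iff.1 hk
  obtain ⟨zh, hzh, hv, hw, hc⟩ := FactorParams.exists_pair_eq_of_mem_Pmnk hmem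
  obtain ⟨R, ε, hε, hbound⟩ :=
    FactorParams.exists_norm_le_of_dist_lt (k := k) (qh := qh) hkm hkn hmem.1.1
  rw [← hzh] at hbound
  obtain ⟨δ, hδ, hnear⟩ := exists_unique_nearest_of_quadratic_immersion
    (FactorParams.contDiff_pairCoeffs_pair (m := m) (n := n) (k := k))
    FactorParams.continuous_pairCoeffs_pairQuadratic
    FactorParams.pairCoeffs_pairQuadratic_smul
    FactorParams.pairCoeffs_pair_add_smul
    (fun _ => FactorParams.eq_zero_of_pairCoeffs_pairLinear_eq_zero hkm hkn hc)
    (M := pairCoeffs m n '' Pmnk m n k)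
    ((FactorParams.eventually_pair_mem_Pmnk hkm hkn hv hw hc).mono
      fun z hz => Set.mem_image_of_mem _ hz)
    (fun _ => FactorParams.eq_of_pairCoeffs_pair_eq hkm hkn hc) (R := R) hε (by
      rintro _ ⟨⟨p, q⟩, hpq, rfl⟩ hd
      obtain ⟨z, hz, -⟩ := FactorParams.exists_pair_eq_of_mem_Pmnk hpq
      rw [← hz] at hd ⊢
      exact ⟨z, hbound z hd, rfl⟩)
  refine ⟨δ, hδ, fun p q hpq hd => ?_⟩
  have hdist : ∀ rs ∈ Cmn m n, dist (pairCoeffs m n (p, q)) (pairCoeffs m n rs) =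
      pairNorm (p - rs.1) (q - rs.2) := fun rs hrs =>
    dist_pairCoeffs hpq.1.le hpq.2.le hrs.1.le hrs.2.le
  obtain ⟨_, ⟨⟨pt, hpt, rfl⟩, hmin⟩, huniq⟩ := hnear (pairCoeffs m n (p, q)) (by
    rw [hzh, hdist _ hmem.1]
    exact hd)
  refine ⟨pt, ⟨hpt, (pairNorm_eq_theta_iff hpt).2 fun rs hrs => ?_⟩, ?_⟩
  · rw [← hdist _ hpt.1, ← hdist _ hrs.1]
    exact hmin _ ⟨rs, hrs, rfl⟩
  · rintro rs ⟨hrs, hrs'⟩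
    have heq := huniq (pairCoeffs m n rs) ⟨⟨rs, hrs, rfl⟩, by
      rintro _ ⟨x, hx, rfl⟩
      rw [hdist _ hrs.1, hdist _ hx.1]
      exact (pairNorm_eq_theta_iff hrs).1 hrs' x hx⟩
    obtain ⟨h₁, h₂⟩ := pairCoeffs_inj hrs.1.1.le hrs.1.2.le hpt.1.1.le hpt.1.2.le heq
    exact Prod.ext h₁ h₂
end

section
/- Let p, q ∈ ℂ[x] with deg p ≤ m and deg q ≤ n for integers m, n ≥ 1, and let 1 ≤ j ≤ min(m,n). Then for every (w,v) ∈ V_j, ‖p·w − q·v‖² ≤ ((n−j+1)‖p‖² + (m−j+1)‖q‖²)·‖(w,v)‖². In particular, the operator norm of S_j(p,q) is at most √(max(m,n) − j + 1)·‖(p,q)‖. -/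
open Polynomial

lemma pnormSq_nonneg (p : ℂ[X]) : 0 ≤ pnormSq p :=
  Finset.sum_nonneg fun _ _ => sq_nonneg _

lemma pnormSq_eq_sum_range {p : ℂ[X]} {N : ℕ} (h : p.natDegree < N) :
    pnormSq p = ∑ k ∈ Finset.range N, ‖p.coeff k‖ ^ 2 := by
  refine Finset.sum_subset (fun k hk => ?_) (fun k _ hk => ?_)
  · exact Finset.mem_range.2 ((le_natDegree_of_mem_supp k hk).trans_lt h)
  · simp [notMem_support_iff.1 hk]

lemma pnormSq_X_pow_mul (p : ℂ[X]) (i : ℕ) : pnormSq (X ^ i * p) = pnormSq p := by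
  have h : (X ^ i * p).natDegree < i + (p.natDegree + 1) := by
    have := natDegree_mul_le (p := X ^ i) (q := p)
    rw [natDegree_X_pow] at this
    omega
  rw [pnormSq_eq_sum_range h, pnormSq_eq_sum_range p.natDegree.lt_succ_self,
    Finset.sum_range_add, Finset.sum_eq_zero, zero_add]
  · refine Finset.sum_congr rfl fun k _ => ?_
    rw [add_comm, coeff_X_pow_mul]
  · intro k hk
    simp [coeff_X_pow_mul', not_le.2 (Finset.mem_range.1 hk)]

lemma coeff_mul_eq_sum_shift (p : ℂ[X]) {w : ℂ[X]} {N : ℕ} (h : w.natDegree < N) (k : ℕ) :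
    (p * w).coeff k = ∑ i ∈ Finset.range N, w.coeff i * (X ^ i * p).coeff k := by
  conv_lhs => rw [mul_comm, w.as_sum_range_C_mul_X_pow' h]
  simp [Finset.sum_mul, mul_assoc]

lemma norm_coeff_mul_sub_mul_sq_le (p q : ℂ[X]) {w v : ℂ[X]} {a b : ℕ}
    (hw : w.natDegree < a) (hv : v.natDegree < b) (k : ℕ) :
    ‖(p * w - q * v).coeff k‖ ^ 2 ≤ (pnormSq w + pnormSq v) *
      (∑ i ∈ Finset.range a, ‖(X ^ i * p).coeff k‖ ^ 2 +
        ∑ i ∈ Finset.range b, ‖(X ^ i * q).coeff k‖ ^ 2) := by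
  have hnorm : ‖(p * w - q * v).coeff k‖ ≤
      ∑ i ∈ Finset.range a, ‖w.coeff i‖ * ‖(X ^ i * p).coeff k‖ +
        ∑ i ∈ Finset.range b, ‖v.coeff i‖ * ‖(X ^ i * q).coeff k‖ := by
    rw [coeff_sub, coeff_mul_eq_sum_shift p hw, coeff_mul_eq_sum_shift q hv]
    refine (norm_sub_le _ _).trans (add_le_add ?_ ?_) <;>
      exact (norm_sum_le _ _).trans_eq (Finset.sum_congr rfl fun _ _ => norm_mul _ _)
  have hcs := Finset.sum_mul_sq_le_sq_mul_sq ((Finset.range a).disjSum (Finset.range b))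
    (Sum.elim (fun i => ‖w.coeff i‖) fun i => ‖v.coeff i‖)
    (Sum.elim (fun i => ‖(X ^ i * p).coeff k‖) fun i => ‖(X ^ i * q).coeff k‖)
  simp only [Finset.sum_disjSum, Sum.elim_inl, Sum.elim_inr] at hcs
  rw [pnormSq_eq_sum_range hw, pnormSq_eq_sum_range hv]
  exact (pow_le_pow_left₀ (norm_nonneg _) hnorm 2).trans hcs

lemma sum_sum_norm_coeff_X_pow_mul_sq_le (p : ℂ[X]) (a N : ℕ) :
    ∑ k ∈ Finset.range N, ∑ i ∈ Finset.range a, ‖(X ^ i * p).coeff k‖ ^ 2 ≤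
      a * pnormSq p := by
  rw [Finset.sum_comm]
  have h : ∀ i ∈ Finset.range a,
      ∑ k ∈ Finset.range N, ‖(X ^ i * p).coeff k‖ ^ 2 ≤ pnormSq p := fun i _ => by
    rw [← pnormSq_X_pow_mul p i, pnormSq_eq_sum_range
      (lt_max_of_lt_right (b := N) (X ^ i * p).natDegree.lt_succ_self)]
    exact Finset.sum_le_sum_of_subset_of_nonneg
      (Finset.range_mono (le_max_left _ _)) fun _ _ _ => sq_nonneg _
  simpa using Finset.sum_le_sum h

lemma pnormSq_mul_sub_mul_le (p q : ℂ[X]) {w v : ℂ[X]} {a b : ℕ}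
    (hw : w.natDegree < a) (hv : v.natDegree < b) :
    pnormSq (p * w - q * v) ≤
      (a * pnormSq p + b * pnormSq q) * (pnormSq w + pnormSq v) := by
  rw [pnormSq_eq_sum_range (p * w - q * v).natDegree.lt_succ_self]
  refine (Finset.sum_le_sum fun k _ => norm_coeff_mul_sub_mul_sq_le p q hw hv k).trans ?_
  rw [← Finset.mul_sum, Finset.sum_add_distrib, mul_comm]
  have := pnormSq_nonneg w
  have := pnormSq_nonneg v
  gcongr <;> exact sum_sum_norm_coeff_X_pow_mul_sq_le _ _ _

/-- Norm bound for the Sylvester map: ‖p·w − q·v‖² ≤ ((n−j+1)‖p‖² + (m−j+1)‖q‖²)·‖(w,v)‖²,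
hence its operator norm is at most √(max(m,n)−j+1)·‖(p,q)‖. -/
theorem sylvester_norm_bound (m n : ℕ) (hm : 1 ≤ m) (hn : 1 ≤ n)
    (p q : ℂ[X]) (hp : p.degree ≤ (m : WithBot ℕ)) (hq : q.degree ≤ (n : WithBot ℕ))
    (j : ℕ) (hj1 : 1 ≤ j) (hj : j ≤ min m n) :
    ∀ w v : ℂ[X], w.degree ≤ ((n - j : ℕ) : WithBot ℕ) →
      v.degree ≤ ((m - j : ℕ) : WithBot ℕ) →
      pnormSq (p * w - q * v) ≤
        (((n - j + 1 : ℕ) : ℝ) * pnormSq p + ((m - j + 1 : ℕ) : ℝ) * pnormSq q) *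
          (pnormSq w + pnormSq v) ∧
      pnorm (p * w - q * v) ≤
        Real.sqrt ((max m n - j + 1 : ℕ)) * pairNorm p q * pairNorm w v := by
  intro w v hw hv
  have hsq := pnormSq_mul_sub_mul_le p q (Nat.lt_succ_of_le (natDegree_le_of_degree_le hw))
    (Nat.lt_succ_of_le (natDegree_le_of_degree_le hv))
  refine ⟨hsq, ?_⟩
  have hp0 := pnormSq_nonneg p
  have hq0 := pnormSq_nonneg q
  have hw0 := pnormSq_nonneg w
  have hv0 := pnormSq_nonneg v
  rw [pnorm, pairNorm, pairNorm, ← Real.sqrt_mul (Nat.cast_nonneg _),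
    ← Real.sqrt_mul (by positivity)]
  refine Real.sqrt_le_sqrt (hsq.trans ?_)
  rw [mul_add ((max m n - j + 1 : ℕ) : ℝ)]
  gcongr <;> omega
end
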